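/- Let V ⊊ ℂ be an unbounded simply connected domain with V ∩ {|z| ≤ 1} = ∅, and let f : V → W := {w ∈ ℂ : |w| > 1} be a holomorphic universal covering map. Suppose there exists t with 0 < t < 2 such that Σ_{z ∈ f⁻¹(w)} 1/(|z|ᵗ·|f′(z)|ᵗ) < ∞ for all w ∈ W. Let q : V → ℂ be holomorphic with |q(z)| ≤ C/|z|² for some constant C > 0 and all z ∈ V. Then the function σ(w) := Σ_{z ∈ f⁻¹(w)} q(z)/f′(z)² is well defined (the series converges absolutely for every w ∈ W), and there exist ε > 0 and C′ > 0 such that |σ(w)| ≤ C′·(log|w|)²/|w|^{2+ε} for all sufficiently large |w|; in particular σ(w) = o(1/|w|²) as w → ∞. -/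

import Mathlib

open Complex Set Filter Topology Metric MeasureTheory
open scoped ENNReal Real

noncomputable def logPlus (x : ℝ) : ℝ := max 0 (Real.log x)

noncomputable def entireOrder (f : ℂ → ℂ) : ℝ≥0∞ :=
  Filter.limsup
    (fun z : ℂ => ENNReal.ofReal (logPlus (logPlus ‖f z‖) / Real.log ‖z‖))
    (Filter.comap (fun z : ℂ => ‖z‖) Filter.atTop)

def IsRegularValue (f : ℂ → ℂ) (w : ℂ) : Prop :=
  ∃ U : Set ℂ, IsOpen U ∧ w ∈ U ∧
    ∀ z ∈ f ⁻¹' U,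
      ∃ e : ↥(connectedComponentIn (f ⁻¹' U) z) ≃ₜ ↥U,
        ∀ x : ↥(connectedComponentIn (f ⁻¹' U) z), (e x : ℂ) = f ↑x

def singularSet (f : ℂ → ℂ) : Set ℂ := {w : ℂ | ¬ IsRegularValue f w}

def TranscendentalEntire (f : ℂ → ℂ) : Prop :=
  Differentiable ℂ f ∧ ¬ ∃ p : Polynomial ℂ, ∀ z, f z = p.eval z

def TopEquiv (f g : ℂ → ℂ) : Prop :=
  ∃ φ ψ : ℂ ≃ₜ ℂ, ∀ z, ψ (f z) = g (φ z)

noncomputable def cylArea (A : Set ℂ) : ℝ≥0∞ :=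
  ∫⁻ z in A, ENNReal.ofReal (1 / ‖z‖ ^ 2)

def AreaProperty (f : ℂ → ℂ) : Prop :=
  ∀ K : Set ℂ, IsCompact K → K ⊆ (singularSet f)ᶜ →
    cylArea (f ⁻¹' K \ Metric.ball (0 : ℂ) 1) < ⊤

/-- A continuous local right inverse of a holomorphic function is holomorphic, even at the critical
points of that function. -/
lemma differentiableAt_of_eventually_rightInverse {F ψ : ℂ → ℂ} {a : ℂ}
    (hF : AnalyticAt ℂ F (ψ a)) (hψ : ∀ᶠ y in 𝓝 a, ContinuousAt ψ y)
    (h : ∀ᶠ y in 𝓝 a, F (ψ y) = y) : DifferentiableAt ℂ ψ a := by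
  have hψa : ContinuousAt ψ a := hψ.self_of_nhds
  have hinj : Tendsto ψ (𝓝[≠] a) (𝓝[≠] (ψ a)) := by
    refine tendsto_nhdsWithin_iff.2 ⟨hψa.tendsto.mono_left nhdsWithin_le_nhds, ?_⟩
    filter_upwards [self_mem_nhdsWithin, nhdsWithin_le_nhds h] with y hy hFy hya
    refine hy ?_
    rw [mem_singleton_iff] at hya ⊢
    rw [← hFy, hya, h.self_of_nhds]
  have hana : ∀ᶠ z in 𝓝 (ψ a), AnalyticAt ℂ F z := hF.eventually_analyticAt
  rcases hF.deriv.eventually_eq_zero_or_eventually_ne_zero with h0 | h0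
  · obtain ⟨ρ, hρ, hball⟩ := Metric.eventually_nhds_iff_ball.1 (h0.and hana)
    have hconst : ∀ z ∈ ball (ψ a) ρ, F z = F (ψ a) := by
      intro z hz
      refine isOpen_ball.is_const_of_deriv_eq_zero (convex_ball _ _).isPreconnected
        (fun x hx => (hball x hx).2.differentiableAt.differentiableWithinAt)
        (fun x hx => (hball x hx).1) hz (mem_ball_self hρ)
    have : ∀ᶠ y in 𝓝 a, y = a := by
      filter_upwards [h, hψa.eventually (ball_mem_nhds _ hρ)] with y hy hyb
      rw [← hy, hconst _ hyb, h.self_of_nhds]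
    have h2 : (∀ᶠ y in 𝓝[≠] a, False) := by
      filter_upwards [nhdsWithin_le_nhds this, self_mem_nhdsWithin] with y hy hy' using hy' hy
    exact absurd (eventually_false_iff_eq_bot.1 h2) (NeBot.ne inferInstance)
  · refine (analyticAt_of_differentiable_on_punctured_nhds_of_continuousAt ?_ hψa).differentiableAt
    filter_upwards [hinj.eventually h0, nhdsWithin_le_nhds hψ,
      nhdsWithin_le_nhds h.eventually_nhds,
      nhdsWithin_le_nhds (hψa.eventually hana)] with y hy hc hh hA
    exact (HasDerivAt.of_local_left_inverse hc hA.differentiableAt.hasDerivAt hy hh).differentiableAt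

/-- If the derivative on a disc is at most twice its value at the centre, then the image contains a
disc of comparable size around the image of the centre. -/
lemma ball_subset_image_of_norm_deriv_le {F : ℂ → ℂ} {a : ℂ} {ρ : ℝ} (hρ : 0 < ρ)
    (hF : DifferentiableOn ℂ F (ball a ρ)) (ha : deriv F a ≠ 0)
    (hb : ∀ z ∈ ball a ρ, ‖deriv F z‖ ≤ 2 * ‖deriv F a‖) :
    ball (F a) (ρ * ‖deriv F a‖ / 24) ⊆ F '' closedBall a (ρ / 6) := by
  set M := ‖deriv F a‖ with hM
  have hM0 : 0 < M := norm_pos_iff.2 ha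
  have hdF : DifferentiableOn ℂ (deriv F) (ball a ρ) := hF.deriv isOpen_ball
  have hmaps : MapsTo (deriv F) (ball a ρ) (closedBall (deriv F a) (3 * M)) := by
    intro z hz
    rw [mem_closedBall, dist_eq_norm]
    linarith [norm_sub_le (deriv F z) (deriv F a), hb z hz]
  have hsub : closedBall a (ρ / 6) ⊆ ball a ρ := closedBall_subset_ball (by linarith)
  have hclose : ∀ z ∈ closedBall a (ρ / 6), ‖deriv F z - deriv F a‖ ≤ M / 2 := by
    intro z hz
    have h1 := Complex.dist_le_div_mul_dist_of_mapsTo_ball hdF hmaps (hsub hz)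
    rw [dist_eq_norm] at h1
    refine h1.trans ?_
    calc 3 * M / ρ * dist z a ≤ 3 * M / ρ * (ρ / 6) := by
          gcongr; exact hz
      _ = M / 2 := by field_simp; norm_num
  have hlow : ∀ z ∈ sphere a (ρ / 6), ρ * M / 12 ≤ ‖F z - F a‖ := by
    intro z hz
    have hz' : ‖z - a‖ = ρ / 6 := by rwa [mem_sphere, dist_eq_norm] at hz
    have hmv : ‖(F z - deriv F a * z) - (F a - deriv F a * a)‖ ≤ M / 2 * ‖z - a‖ := by
      refine (convex_closedBall a (ρ / 6)).norm_image_sub_le_of_norm_hasDerivWithin_le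
        (f := fun z => F z - deriv F a * z) (f' := fun z => deriv F z - deriv F a)
        (fun x hx => ?_) hclose (mem_closedBall_self (by linarith)) (sphere_subset_closedBall hz)
      have h1 := (hF.differentiableAt (isOpen_ball.mem_nhds (hsub hx))).hasDerivAt
      have h2 := (hasDerivAt_id x).const_mul (deriv F a)
      simp only [mul_one, id] at h2
      exact (h1.sub h2).hasDerivWithinAt
    have h2 : F z - F a
        = deriv F a * (z - a) + ((F z - deriv F a * z) - (F a - deriv F a * a)) := by ring
    have h3 : ‖deriv F a * (z - a)‖ - ‖(F z - deriv F a * z) - (F a - deriv F a * a)‖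
        ≤ ‖F z - F a‖ := by
      rw [h2]; exact norm_sub_le_norm_add _ _
    rw [norm_mul, hz'] at h3
    rw [hz'] at hmv
    linarith
  have hd : DiffContOnCl ℂ F (ball a (ρ / 6)) :=
    (hF.mono (closure_ball_subset_closedBall.trans hsub)).diffContOnCl
  have hne : ∃ᶠ z in 𝓝 a, F z ≠ F a := by
    have hA : DifferentiableAt ℂ F a := hF.differentiableAt (ball_mem_nhds _ hρ)
    exact (hA.hasDerivAt.eventually_ne ha).frequently.filter_mono nhdsWithin_le_nhds
  have := hd.ball_subset_image_closedBall (by positivity) hlow hne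
  rwa [show ρ * M / 12 / 2 = ρ * M / 24 by ring] at this

/-- A weak form of the Bloch theorem. -/
lemma exists_ball_subset_image {F : ℂ → ℂ} {c : ℂ} {r : ℝ} (hr : 0 < r)
    (hF : DifferentiableOn ℂ F (ball c r)) (hc : deriv F c ≠ 0) :
    ∃ a ∈ ball c r, ball (F a) (r * ‖deriv F c‖ / 96) ⊆ F '' ball c r := by
  set s := r / 2 with hs
  have hsub : closedBall c s ⊆ ball c r := closedBall_subset_ball (by linarith)
  have hdF : ContinuousOn (deriv F) (ball c r) := (hF.deriv isOpen_ball).continuousOn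
  have hcont : ContinuousOn (fun z => (s - dist z c) * ‖deriv F z‖) (closedBall c s) := by
    have := (hdF.mono hsub).norm
    fun_prop
  obtain ⟨a, ha, hmax⟩ := (isCompact_closedBall c s).exists_isMaxOn
    ⟨c, mem_closedBall_self (by positivity)⟩ hcont
  have hc' : s * ‖deriv F c‖ ≤ (s - dist a c) * ‖deriv F a‖ := by
    simpa using hmax (mem_closedBall_self (by positivity : 0 ≤ s))
  have hpos : 0 < (s - dist a c) * ‖deriv F a‖ :=
    lt_of_lt_of_le (mul_pos (by positivity) (norm_pos_iff.2 hc)) hc'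
  have hda : 0 < s - dist a c := pos_of_mul_pos_left hpos (norm_nonneg _)
  have hFa : deriv F a ≠ 0 := by
    intro h; simp [h] at hpos
  set ρ := (s - dist a c) / 2 with hρ
  have hρ0 : 0 < ρ := by positivity
  have hin : ball a ρ ⊆ closedBall c s := by
    intro z hz
    rw [mem_ball] at hz
    rw [mem_closedBall]
    linarith [dist_triangle z a c]
  have key := ball_subset_image_of_norm_deriv_le hρ0 (hF.mono (hin.trans hsub)) hFa (by
    intro z hz
    have h1 : (s - dist z c) * ‖deriv F z‖ ≤ (s - dist a c) * ‖deriv F a‖ := hmax (hin hz)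
    have h2 : ρ ≤ s - dist z c := by
      rw [mem_ball] at hz
      linarith [dist_triangle z a c]
    have h3 : ρ * ‖deriv F z‖ ≤ ρ * (2 * ‖deriv F a‖) := by
      calc ρ * ‖deriv F z‖ ≤ (s - dist z c) * ‖deriv F z‖ := by gcongr
        _ ≤ _ := h1
        _ = ρ * (2 * ‖deriv F a‖) := by rw [hρ]; ring
    exact le_of_mul_le_mul_left h3 hρ0)
  refine ⟨a, hsub ha, (ball_subset_ball ?_).trans (key.trans (image_mono ?_))⟩
  · rw [hρ]; nlinarith
  · exact ((closedBall_subset_ball (by linarith)).trans hin).trans hsub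

/-- A zero-free holomorphic function on a disc has a holomorphic logarithm. -/
lemma exists_log_on_ball {u : ℂ → ℂ} {c : ℂ} {r : ℝ} (hr : 0 < r)
    (hu : DifferentiableOn ℂ u (ball c r)) (h0 : ∀ z ∈ ball c r, u z ≠ 0) :
    ∃ L : ℂ → ℂ, ∀ z ∈ ball c r, HasDerivAt L (deriv u z / u z) z ∧ exp (L z) = u z := by
  have hcm := mem_ball_self (x := c) hr
  obtain ⟨L, hLc, hL⟩ := ((hu.deriv isOpen_ball).div hu h0).isExactOn_ball.with_val_at c
    (log (u c))
  refine ⟨L, fun z hz => ⟨hL z hz, ?_⟩⟩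
  have hd : ∀ z ∈ ball c r, HasDerivAt (fun z => exp (L z) / u z) 0 z := by
    intro z hz
    refine (((hL z hz).cexp).div
      (hu.differentiableAt (isOpen_ball.mem_nhds hz)).hasDerivAt (h0 z hz)).congr_deriv ?_
    rw [div_eq_zero_iff, Pi.div_apply, mul_assoc, div_mul_cancel₀ _ (h0 z hz), sub_self]
    exact Or.inl rfl
  have h2 := isOpen_ball.is_const_of_deriv_eq_zero (convex_ball c r).isPreconnected
    (fun x hx => (hd x hx).differentiableAt.differentiableWithinAt)
    (fun x hx => (hd x hx).deriv) hz hcm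
  simp only [hLc, exp_log (h0 c hcm), div_self (h0 c hcm)] at h2
  exact (div_eq_one_iff_eq (h0 z hz)).1 h2

/-- The logarithmic derivative of an injective zero-free holomorphic function on a disc is bounded
in terms of the radius. -/
lemma norm_logDeriv_le_of_injOn {ψ : ℂ → ℂ} {c : ℂ} {r : ℝ} (hr : 0 < r)
    (hψ : DifferentiableOn ℂ ψ (ball c r)) (h0 : ∀ z ∈ ball c r, ψ z ≠ 0)
    (hinj : InjOn ψ (ball c r)) : ‖deriv ψ c / ψ c‖ ≤ 192 * π / r := by
  obtain ⟨L, hLog⟩ := exists_log_on_ball hr hψ h0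
  have hL := fun z hz => (hLog z hz).1
  have hexp := fun z hz => (hLog z hz).2
  have hcm := mem_ball_self (x := c) hr
  have hLd : deriv L c = deriv ψ c / ψ c := (hL c hcm).deriv
  rw [← hLd]
  by_contra! hlt
  have hne : deriv L c ≠ 0 := by
    intro h
    rw [h, norm_zero] at hlt
    exact absurd hlt (by have := Real.pi_pos; push Not; positivity)
  obtain ⟨a, ha, hsub⟩ := exists_ball_subset_image hr
    (fun z hz => (hL z hz).differentiableAt.differentiableWithinAt) hne
  have hmem : L a + 2 * π * I ∈ ball (L a) (r * ‖deriv L c‖ / 96) := by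
    rw [div_lt_iff₀ hr] at hlt
    rw [mem_ball, dist_eq_norm, add_sub_cancel_left]
    simp only [norm_mul, norm_ofNat, norm_real, norm_I, mul_one, Real.norm_eq_abs,
      abs_of_pos Real.pi_pos]
    linarith
  obtain ⟨b, hb, hba⟩ := hsub hmem
  have : ψ b = ψ a := by rw [← hexp b hb, ← hexp a ha, hba, exp_add, exp_two_pi_mul_I, mul_one]
  rw [hinj hb ha this] at hba
  exact two_pi_I_ne_zero (left_eq_add.1 hba)

/-- A Harnack-type inequality for zero-free bounded holomorphic functions. -/
lemma norm_sq_le_of_ne_zero {u : ℂ → ℂ} {c : ℂ} {r M t : ℝ} (hr : 0 < r)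
    (ht0 : 0 < t) (ht2 : t < 2) (hu : DifferentiableOn ℂ u (ball c r))
    (h0 : ∀ z ∈ ball c r, u z ≠ 0) (hM : ∀ z ∈ ball c r, ‖u z‖ < M)
    {z : ℂ} (hz : z ∈ ball c ((2 - t) / 8 * r)) :
    ‖u z‖ ^ 2 ≤ M ^ (2 - t) * ‖u c‖ ^ t := by
  have hcm := mem_ball_self (x := c) hr
  have hM0 : 0 < M := (norm_nonneg _).trans_lt (hM c hcm)
  obtain ⟨L, hLog⟩ := exists_log_on_ball hr hu h0
  have hL := fun z hz => (hLog z hz).1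
  have hexp := fun z hz => (hLog z hz).2
  have hnorm : ∀ z ∈ ball c r, (L z).re = Real.log ‖u z‖ := by
    intro z hz
    rw [← hexp z hz, norm_exp, Real.log_exp]
  have hlt : ∀ z ∈ ball c r, Real.log ‖u z‖ < Real.log M := fun z hz =>
    Real.log_lt_log (norm_pos_iff.2 (h0 z hz)) (hM z hz)
  set A := Real.log M - Real.log ‖u c‖ with hA
  have hA0 : 0 < A := sub_pos.2 (hlt c hcm)
  have hshift : MapsTo (fun w => c + w) (ball 0 r) (ball c r) := by
    intro w hw
    simpa using hw
  set d := ‖z - c‖ with hd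
  have hd' : d < (2 - t) / 8 * r := by rwa [mem_ball, dist_eq_norm] at hz
  have hdr : d < r := by nlinarith
  have hzr : z ∈ ball c r := by rwa [mem_ball, dist_eq_norm]
  have hBC := Complex.borelCaratheodory_zero (f := fun w => L (c + w) - L c) (M := A) (R := r)
    (z := z - c) hA0
    (by
      intro w hw
      have := ((hL _ (hshift hw)).differentiableAt.comp w
        (differentiableAt_id.const_add c)).sub_const (L c)
      exact this.differentiableWithinAt)
    (by
      intro w hw
      simp only [mem_ofPred_eq, sub_re, hnorm _ (hshift hw), hnorm c hcm]
      linarith [hlt _ (hshift hw)])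
    hr (by rwa [mem_ball, dist_zero_right]) (by simp)
  simp only [add_sub_cancel] at hBC
  have hre : Real.log ‖u z‖ - Real.log ‖u c‖ ≤ 2 * A * d / (r - d) := by
    rw [← hnorm z hzr, ← hnorm c hcm, ← sub_re]
    exact (re_le_norm _).trans hBC
  have hfrac : 2 * A * d / (r - d) ≤ (1 - t / 2) * A := by
    rw [div_le_iff₀ (by linarith)]
    have : 2 * d ≤ (1 - t / 2) * (r - d) := by
      have hd4 : d ≤ r / 4 := by nlinarith
      nlinarith
    nlinarith
  have hfin : 2 * Real.log ‖u z‖ ≤ (2 - t) * Real.log M + t * Real.log ‖u c‖ := by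
    rw [hA] at hfrac hre
    nlinarith
  have huz := norm_pos_iff.2 (h0 z hzr)
  have huc := norm_pos_iff.2 (h0 c hcm)
  rw [← Real.log_le_log_iff (by positivity) (by positivity), Real.log_pow,
    Real.log_mul (by positivity) (by positivity), Real.log_rpow hM0, Real.log_rpow huc]
  exact_mod_cast hfin

lemma one_le_norm_one_add_mul {a δ : ℝ} (hδ : 0 < δ) {z : ℂ} (hz : a ≤ z.re) :
    1 ≤ ‖1 + (δ : ℂ) * (z - a)‖ := by
  refine le_trans ?_ (re_le_norm _)
  simp only [add_re, one_re, re_ofReal_mul, sub_re, ofReal_re, le_add_iff_nonneg_right]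
  exact mul_nonneg hδ.le (sub_nonneg.2 hz)

lemma mul_norm_le_norm_one_add_mul {a δ : ℝ} (hδ : 0 < δ) {z : ℂ} (hz : a ≤ z.re) :
    δ * ‖z - a‖ ≤ ‖1 + (δ : ℂ) * (z - a)‖ := by
  have h : δ * ‖z - a‖ = ‖(δ : ℂ) * (z - a)‖ := by
    rw [norm_mul, norm_real, Real.norm_of_nonneg hδ.le]
  rw [h, ← sq_le_sq₀ (norm_nonneg _) (norm_nonneg _), Complex.sq_norm, Complex.sq_norm,
    normSq_apply, normSq_apply]
  have : 0 ≤ δ * (z.re - a) := mul_nonneg hδ.le (sub_nonneg.2 hz)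
  simp only [add_re, one_re, re_ofReal_mul, sub_re, ofReal_re, add_im, one_im, im_ofReal_mul,
    sub_im, ofReal_im]
  nlinarith

/-- The integral of a bounded holomorphic function on a half-plane over the boundary line vanishes
after multiplication by a quadratically decaying kernel. -/
lemma integral_vertical_div_sq_eq_zero {G : ℂ → ℂ} {a M δ : ℝ} (hδ : 0 < δ)
    (hG : DifferentiableOn ℂ G {z | a ≤ z.re}) (hM : ∀ z : ℂ, a ≤ z.re → ‖G z‖ ≤ M)
    (hint : Integrable fun y : ℝ => G (a + y * I) / (1 + δ * ((a + y * I : ℂ) - a)) ^ 2) :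
    ∫ y : ℝ, G (a + y * I) / (1 + δ * ((a + y * I : ℂ) - a)) ^ 2 = 0 := by
  set E : ℂ → ℂ := fun z => G z / (1 + δ * (z - a)) ^ 2 with hE
  have hM0 : 0 ≤ M := (norm_nonneg _).trans (hM a (by simp))
  have hne : ∀ z : ℂ, a ≤ z.re → (1 + δ * (z - a) : ℂ) ≠ 0 := fun z hz =>
    norm_pos_iff.1 (one_pos.trans_le (one_le_norm_one_add_mul hδ hz))
  have hEd : DifferentiableOn ℂ E {z | a ≤ z.re} :=
    hG.div (by fun_prop) fun z hz => pow_ne_zero 2 (hne z hz)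
  have hEb : ∀ T : ℝ, 0 < T → ∀ z : ℂ, a ≤ z.re → T ≤ ‖z - a‖ → ‖E z‖ ≤ M / (δ * T) ^ 2 := by
    intro T hT z hz hTz
    rw [hE]
    simp only [norm_div, norm_pow]
    have := mul_norm_le_norm_one_add_mul hδ hz
    gcongr
    · exact hM z hz
    · exact (mul_le_mul_of_nonneg_left hTz hδ.le).trans this
  have hbound : ∀ T : ℝ, 0 < T →
      ‖∫ y in (-T)..T, E (a + y * I)‖ ≤ 4 * M / δ ^ 2 * T⁻¹ := by
    intro T hT
    have hrect := integral_boundary_rect_eq_zero_of_differentiableOn E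
      (a + (-T : ℝ) * I) ((a + T : ℝ) + T * I) (hEd.mono (by
        rintro z hz
        have := hz.1
        simp only [mem_preimage, add_re, ofReal_re, mul_re, I_re, ofReal_im, I_im] at this
        rw [uIcc_of_le (by linarith)] at this
        have := this.1
        simp only [mul_zero, sub_zero, add_zero, zero_mul] at this
        exact this))
    simp only [add_re, ofReal_re, mul_re, I_re, ofReal_im, I_im, add_im, mul_im, mul_zero,
      mul_one, sub_zero, add_zero, zero_add, smul_eq_mul] at hrect
    have h1 : ‖∫ x in a..(a + T), E (x + (-T : ℝ) * I)‖ ≤ M / (δ * T) ^ 2 * |a + T - a| := by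
      refine intervalIntegral.norm_integral_le_of_norm_le_const fun x hx => ?_
      rw [uIoc_of_le (by linarith)] at hx
      refine hEb T hT _ (by simpa using hx.1.le) ?_
      refine le_trans ?_ (abs_im_le_norm _)
      simp [abs_of_pos hT]
    have h2 : ‖∫ x in a..(a + T), E (x + T * I)‖ ≤ M / (δ * T) ^ 2 * |a + T - a| := by
      refine intervalIntegral.norm_integral_le_of_norm_le_const fun x hx => ?_
      rw [uIoc_of_le (by linarith)] at hx
      refine hEb T hT _ (by simpa using hx.1.le) ?_
      refine le_trans ?_ (abs_im_le_norm _)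
      simp [abs_of_pos hT]
    have h3 : ‖∫ y in (-T)..T, E ((a + T : ℝ) + y * I)‖ ≤ M / (δ * T) ^ 2 * |T - -T| := by
      refine intervalIntegral.norm_integral_le_of_norm_le_const fun x hx => ?_
      refine hEb T hT _ (by simpa using hT.le) ?_
      refine le_trans ?_ (re_le_norm _)
      simp
    have habs1 : |a + T - a| = T := by rw [add_sub_cancel_left, abs_of_pos hT]
    have habs2 : |T - -T| = 2 * T := by rw [sub_neg_eq_add, ← two_mul, abs_of_pos (by linarith)]
    rw [habs1] at h1 h2
    rw [habs2] at h3
    have heq : I * ∫ y in (-T)..T, E (a + y * I) = (∫ x in a..(a + T), E (x + (-T : ℝ) * I))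
        - (∫ x in a..(a + T), E (x + T * I)) + I * ∫ y in (-T)..T, E ((a + T : ℝ) + y * I) :=
      (sub_eq_zero.1 hrect).symm
    calc ‖∫ y in (-T)..T, E (a + y * I)‖ = ‖I * ∫ y in (-T)..T, E (a + y * I)‖ := by
          rw [norm_mul, norm_I, one_mul]
      _ ≤ M / (δ * T) ^ 2 * T + M / (δ * T) ^ 2 * T + M / (δ * T) ^ 2 * (2 * T) := by
          rw [heq]
          refine (norm_add_le _ _).trans (add_le_add ((norm_sub_le _ _).trans
            (add_le_add h1 h2)) ?_)
          rwa [norm_mul, norm_I, one_mul]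
      _ = 4 * M / δ ^ 2 * T⁻¹ := by field_simp; ring
  have hlim := intervalIntegral_tendsto_integral hint tendsto_neg_atTop_atBot tendsto_id
  have h0 : Tendsto (fun T : ℝ => 4 * M / δ ^ 2 * T⁻¹) atTop (𝓝 0) := by
    have := (tendsto_inv_atTop_zero (𝕜 := ℝ)).const_mul (4 * M / δ ^ 2)
    rwa [mul_zero] at this
  refine tendsto_nhds_unique hlim (squeeze_zero_norm' ?_ h0)
  filter_upwards [eventually_gt_atTop 0] with T hT using hbound T hT

/-- The integral of a bounded holomorphic function on a half-plane over the boundary line vanishes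
as soon as it converges absolutely. -/
lemma integral_vertical_eq_zero {G : ℂ → ℂ} {a M : ℝ}
    (hG : DifferentiableOn ℂ G {z | a ≤ z.re}) (hM : ∀ z : ℂ, a ≤ z.re → ‖G z‖ ≤ M)
    (hint : Integrable fun y : ℝ => G (a + y * I)) : ∫ y : ℝ, G (a + y * I) = 0 := by
  set δ : ℕ → ℝ := fun n => 1 / ((n : ℝ) + 1) with hδ
  have hδ0 : ∀ n, 0 < δ n := fun n => by positivity
  have hre : ∀ y : ℝ, a ≤ (a + y * I : ℂ).re := fun y => by simp
  have hmeas : ∀ n, AEStronglyMeasurable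
      (fun y : ℝ => G (a + y * I) / (1 + δ n * ((a + y * I : ℂ) - a)) ^ 2) := by
    intro n
    simp only [div_eq_mul_inv]
    refine hint.aestronglyMeasurable.mul (Continuous.aestronglyMeasurable ?_)
    refine Continuous.inv₀ (by fun_prop) fun y => pow_ne_zero 2 (norm_pos_iff.1 ?_)
    exact one_pos.trans_le (one_le_norm_one_add_mul (hδ0 n) (hre y))
  have hle : ∀ n, ∀ y : ℝ, ‖G (a + y * I) / (1 + δ n * ((a + y * I : ℂ) - a)) ^ 2‖
      ≤ ‖G (a + y * I)‖ := by
    intro n y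
    rw [norm_div, norm_pow]
    exact div_le_self (norm_nonneg _) (one_le_pow₀ (one_le_norm_one_add_mul (hδ0 n) (hre y)))
  have hlim := tendsto_integral_of_dominated_convergence (F := fun n (y : ℝ) =>
      G (a + y * I) / (1 + δ n * ((a + y * I : ℂ) - a)) ^ 2) (f := fun y : ℝ => G (a + y * I))
    (fun y => ‖G (a + y * I)‖) hmeas hint.norm (fun n => Eventually.of_forall (hle n))
    (Eventually.of_forall fun y => by
      have h0 : Tendsto (fun n => ((δ n : ℝ) : ℂ)) atTop (𝓝 0) := by
        exact (continuous_ofReal.tendsto' 0 0 (by simp)).comp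
          (tendsto_one_div_add_atTop_nhds_zero_nat (𝕜 := ℝ))
      have h1 := ((h0.mul_const ((a + y * I : ℂ) - a)).const_add 1).pow 2
      simp only [zero_mul, add_zero, one_pow] at h1
      have h2 := (tendsto_const_nhds (x := G (a + y * I))).div h1 one_ne_zero
      rwa [div_one] at h2)
  refine tendsto_nhds_unique hlim (tendsto_const_nhds.congr fun n => ?_)
  exact (integral_vertical_div_sq_eq_zero (hδ0 n) hG hM
    (hint.mono (hmeas n) (Eventually.of_forall (hle n)))).symm

/-- Unfolding: a function with summable integer translates is integrable, and its integral is the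
integral of its periodization. -/
lemma integrable_and_integral_tsum_eq {φ : ℝ → ℂ} (hφ : Continuous φ) {b : ℤ → ℝ} (hb : Summable b)
    (h : ∀ n : ℤ, ∀ x ∈ Icc (0 : ℝ) 1, ‖φ (x + n)‖ ≤ b n) :
    Integrable φ ∧ ∫ x in (0 : ℝ)..1, ∑' n : ℤ, φ (x + n) = ∫ x, φ x := by
  have hb0 : ∀ n, 0 ≤ b n := fun n =>
    (norm_nonneg _).trans (h n 0 (left_mem_Icc.2 zero_le_one))
  have hint : Integrable φ := by
    refine Real.integrable_of_summable_norm_Icc (f := ⟨φ, hφ⟩)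
      (hb.of_nonneg_of_le (fun _ => norm_nonneg _) fun n => ?_)
    exact (ContinuousMap.norm_le _ (hb0 n)).2 fun x => h n x.1 x.2
  refine ⟨hint, ?_⟩
  have h1 := hint.hasSum_intervalIntegral_comp_add_int
  have h2 : HasSum (fun n : ℤ => ∫ x in (0 : ℝ)..1, φ (x + n))
      (∫ x in (0 : ℝ)..1, ∑' n : ℤ, φ (x + n)) := by
    refine intervalIntegral.hasSum_integral_of_dominated_convergence (fun n _ => b n)
      (fun n => ?_) (fun n => ?_) (Eventually.of_forall fun _ _ => hb) ?_
      (Eventually.of_forall fun x hx => ?_)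
    · exact Continuous.aestronglyMeasurable (by fun_prop)
    · refine Eventually.of_forall fun x hx => h n x ?_
      rw [uIoc_of_le zero_le_one] at hx
      exact Ioc_subset_Icc_self hx
    · exact intervalIntegrable_const
    · rw [uIoc_of_le zero_le_one] at hx
      exact (hb.of_norm_bounded fun n => h n x (Ioc_subset_Icc_self hx)).hasSum
  exact h2.unique h1

/-- The sum of a function over all translates by integer multiples of `2πi`. -/
noncomputable def periodize (g : ℂ → ℂ) (ζ : ℂ) : ℂ := ∑' k : ℤ, g (ζ + k * (2 * π * I))

/-- The translates of `g` are summable, locally uniformly on the right half-plane. -/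
def LocallySummableTranslates (g : ℂ → ℂ) : Prop :=
  ∀ z : ℂ, 0 < z.re → ∃ U ∈ 𝓝 z, ∃ b : ℤ → ℝ, Summable b ∧
    ∀ y ∈ U, 0 < y.re → ∀ k : ℤ, ‖g (y + k * (2 * π * I))‖ ≤ b k

lemma LocallySummableTranslates.exists_bound {g : ℂ → ℂ} (hsum : LocallySummableTranslates g)
    {K : Set ℂ} (hK : IsCompact K) (hK0 : ∀ z ∈ K, 0 < z.re) :
    ∃ b : ℤ → ℝ, Summable b ∧ ∀ y ∈ K, ∀ k : ℤ, ‖g (y + k * (2 * π * I))‖ ≤ b k := by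
  have key : ∃ b : ℤ → ℝ, Summable b ∧ (∀ k, 0 ≤ b k) ∧
      ∀ y ∈ K, 0 < y.re → ∀ k : ℤ, ‖g (y + k * (2 * π * I))‖ ≤ b k := by
    refine hK.induction_on (p := fun s => ∃ b : ℤ → ℝ, Summable b ∧ (∀ k, 0 ≤ b k) ∧
      ∀ y ∈ s, 0 < y.re → ∀ k : ℤ, ‖g (y + k * (2 * π * I))‖ ≤ b k) ?_ ?_ ?_ ?_
    · exact ⟨0, summable_zero, fun _ => le_rfl, fun y hy => hy.elim⟩
    · rintro s t hst ⟨b, hb, hb0, h⟩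
      exact ⟨b, hb, hb0, fun y hy => h y (hst hy)⟩
    · rintro s t ⟨b, hb, hb0, h⟩ ⟨b', hb', hb0', h'⟩
      refine ⟨fun k => b k + b' k, hb.add hb', fun k => add_nonneg (hb0 k) (hb0' k), ?_⟩
      rintro y (hy | hy) hy0 k
      · exact (h y hy hy0 k).trans (le_add_of_nonneg_right (hb0' k))
      · exact (h' y hy hy0 k).trans (le_add_of_nonneg_left (hb0 k))
    · intro x hx
      obtain ⟨U, hU, b, hb, h⟩ := hsum x (hK0 x hx)
      exact ⟨U, mem_nhdsWithin_of_mem_nhds hU, fun k => |b k|, hb.abs, fun k => abs_nonneg _,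
        fun y hy hy0 k => (h y hy hy0 k).trans (le_abs_self _)⟩
  obtain ⟨b, hb, -, h⟩ := key
  exact ⟨b, hb, fun y hy => h y hy (hK0 y hy)⟩

lemma re_add_int_mul_two_pi_I (ζ : ℂ) (k : ℤ) : (ζ + k * (2 * π * I)).re = ζ.re := by
  simp

lemma differentiableAt_periodize {g : ℂ → ℂ} (hg : DifferentiableOn ℂ g {z | 0 < z.re})
    (hsum : LocallySummableTranslates g) {ζ : ℂ} (hζ : 0 < ζ.re) :
    DifferentiableAt ℂ (periodize g) ζ := by
  obtain ⟨U, hU, b, hb, h⟩ := hsum ζ hζ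
  have hH : {z : ℂ | 0 < z.re} ∈ 𝓝 ζ := (isOpen_lt continuous_const continuous_re).mem_nhds hζ
  obtain ⟨W, hWU, hWo, hζW⟩ := _root_.mem_nhds_iff.1 (inter_mem hU hH)
  refine (differentiableOn_tsum_of_summable_norm hb (fun k => ?_) hWo
    fun k w hw => h w (hWU hw).1 (hWU hw).2 k).differentiableAt (hWo.mem_nhds hζW)
  refine hg.comp (by fun_prop) fun w hw => ?_
  have := (hWU hw).2
  simpa only [mem_ofPred_eq, re_add_int_mul_two_pi_I] using this

lemma periodize_add_int_mul (g : ℂ → ℂ) (ζ : ℂ) (n : ℤ) :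
    periodize g (ζ + n * (2 * π * I)) = periodize g ζ := by
  unfold periodize
  rw [← (Equiv.addLeft n).tsum_eq (fun k : ℤ => g (ζ + k * (2 * π * I)))]
  refine tsum_congr fun k => ?_
  simp only [Equiv.coe_addLeft, Int.cast_add]
  congr 1
  ring

lemma periodize_log_exp (g : ℂ → ℂ) (ζ : ℂ) : periodize g (log (exp ζ)) = periodize g ζ := by
  obtain ⟨n, hn⟩ := log_exp_exists ζ
  rw [hn, periodize_add_int_mul]

lemma re_log_pos {w : ℂ} (hw : 1 < ‖w‖) : 0 < (log w).re := by
  rw [log_re]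
  exact Real.log_pos hw

lemma differentiableAt_periodize_log {g : ℂ → ℂ} (hg : DifferentiableOn ℂ g {z | 0 < z.re})
    (hsum : LocallySummableTranslates g) {w : ℂ} (hw : 1 < ‖w‖) :
    DifferentiableAt ℂ (fun v => periodize g (log v)) w := by
  have hw0 : w ≠ 0 := norm_pos_iff.1 (one_pos.trans hw)
  have heq : (fun v => periodize g (log v)) =ᶠ[𝓝 w]
      fun v => periodize g (log w + log (v / w)) := by
    filter_upwards [isOpen_ne.mem_nhds hw0] with v hv
    rw [← periodize_log_exp g (log w + log (v / w)), exp_add, exp_log hw0,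
      exp_log (div_ne_zero hv hw0), mul_div_cancel₀ _ hw0]
  refine DifferentiableAt.congr_of_eventuallyEq ?_ heq
  have h1 : DifferentiableAt ℂ (fun v => log w + log (v / w)) w := by
    refine (DifferentiableAt.clog (by fun_prop) ?_).const_add _
    rw [div_self hw0]
    exact one_mem_slitPlane
  refine DifferentiableAt.comp w (g := periodize g) ?_ h1
  rw [div_self hw0, log_one, add_zero]
  exact differentiableAt_periodize hg hsum (re_log_pos hw)

lemma norm_exp_div_exp_sub_le {w ζ : ℂ} {R : ℝ} (hwR : ‖w‖ < R) (hζ : Real.log R ≤ ζ.re) :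
    ‖exp ζ / (exp ζ - w)‖ ≤ R / (R - ‖w‖) := by
  have hR : 0 < R := (norm_nonneg w).trans_lt hwR
  have h1 : R ≤ ‖exp ζ‖ := by
    rw [norm_exp]
    exact (Real.log_le_iff_le_exp hR).1 hζ
  have h2 : ‖exp ζ‖ - ‖w‖ ≤ ‖exp ζ - w‖ := norm_sub_norm_le _ _
  rw [norm_div, div_le_div_iff₀ (by linarith) (by linarith)]
  nlinarith [norm_nonneg w, norm_nonneg (exp ζ)]

/-- The Cauchy integral of a periodized function over a large circle vanishes inside that circle:
unfold it to an integral over a vertical line. -/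
lemma circleIntegral_periodize_log_div_eq_zero {g : ℂ → ℂ} {R M : ℝ} {w : ℂ}
    (hg : DifferentiableOn ℂ g {z | 0 < z.re}) (hsum : LocallySummableTranslates g)
    (hR : 1 < R) (hwR : ‖w‖ < R) (hM : ∀ z : ℂ, Real.log R ≤ z.re → ‖g z‖ ≤ M) :
    ∮ v in C(0, R), periodize g (log v) / (v - w) = 0 := by
  have hR0 : 0 < R := one_pos.trans hR
  set c := Real.log R with hc
  have hc0 : 0 < c := Real.log_pos hR
  set G : ℂ → ℂ := fun ζ => g ζ * (exp ζ / (exp ζ - w)) with hG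
  have hne : ∀ ζ : ℂ, c ≤ ζ.re → exp ζ - w ≠ 0 := by
    intro ζ hζ h
    have h1 : R ≤ ‖exp ζ‖ := by
      rw [norm_exp]
      exact (Real.log_le_iff_le_exp hR0).1 hζ
    rw [sub_eq_zero.1 h] at h1
    linarith
  have hM0 : 0 ≤ M := (norm_nonneg _).trans (hM c (by simp))
  have hgd : DifferentiableOn ℂ g {z | c ≤ z.re} := hg.mono fun z hz => hc0.trans_le hz
  have hGd : DifferentiableOn ℂ G {z | c ≤ z.re} :=
    hgd.mul (DifferentiableOn.div (by fun_prop) (by fun_prop) hne)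
  have hGM : ∀ z : ℂ, c ≤ z.re → ‖G z‖ ≤ M * (R / (R - ‖w‖)) := fun z hz => by
    rw [hG]
    simp only [norm_mul]
    exact mul_le_mul (hM z hz) (norm_exp_div_exp_sub_le hwR hz) (norm_nonneg _) hM0
  set φ : ℝ → ℂ := fun x => G (c + (2 * π * x : ℝ) * I) with hφ
  have hφc : Continuous φ := by
    refine hGd.continuousOn.comp_continuous (by fun_prop) fun x => ?_
    simp
  set S : Set ℂ := (fun x : ℝ => (c + (2 * π * x : ℝ) * I : ℂ)) '' Icc 0 1
  obtain ⟨b, hb, hbS⟩ := hsum.exists_bound (K := S)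
    (isCompact_Icc.image (by fun_prop)) (by rintro _ ⟨x, -, rfl⟩; simpa using hc0)
  have hshift : ∀ x : ℝ, ∀ n : ℤ, (c + (2 * π * (x + n) : ℝ) * I : ℂ) =
      (c + (2 * π * x : ℝ) * I : ℂ) + n * (2 * π * I) := fun x n => by
    push_cast
    ring
  obtain ⟨hint, htsum⟩ := integrable_and_integral_tsum_eq hφc (hb.mul_right (R / (R - ‖w‖)))
    (fun n x hx => by
      simp only [hφ, hG, norm_mul]
      refine mul_le_mul ?_ (norm_exp_div_exp_sub_le hwR (by simp [hc])) (norm_nonneg _) ?_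
      · rw [hshift]
        exact hbS _ ⟨x, hx, rfl⟩ n
      · exact (norm_nonneg _).trans (hbS _ ⟨x, hx, rfl⟩ n))
  have h2π : (2 * π : ℝ) ≠ 0 := by positivity
  have hzero : ∫ x, φ x = 0 := by
    have h1 := integral_vertical_eq_zero hGd hGM
      ((integrable_comp_mul_left_iff (fun y : ℝ => G (c + y * I)) h2π).1 hint)
    have h2 := Measure.integral_comp_mul_left (fun y : ℝ => G (c + y * I)) (2 * π)
    rw [h1, smul_zero] at h2
    exact h2
  rw [hzero] at htsum
  have hcm : ∀ θ : ℝ, circleMap 0 R θ = exp (c + θ * I) := fun θ => by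
    rw [exp_add, ← ofReal_exp, hc, Real.exp_log hR0, circleMap_zero]
  have hpt : ∀ x : ℝ, deriv (circleMap 0 R) (2 * π * x) •
      (periodize g (log (circleMap 0 R (2 * π * x))) / (circleMap 0 R (2 * π * x) - w)) =
      I * ∑' n : ℤ, φ (x + n) := by
    intro x
    rw [deriv_circleMap, hcm, periodize_log_exp, periodize,
      smul_eq_mul, ← tsum_mul_left]
    rw [div_eq_mul_inv, ← tsum_mul_right, ← tsum_mul_left]
    refine tsum_congr fun n => ?_
    simp only [hφ, hG]
    rw [hshift, exp_add _ ((n : ℂ) * _), exp_int_mul_two_pi_mul_I, mul_one]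
    ring
  have h3 := intervalIntegral.integral_comp_mul_left (a := 0) (b := 1) (fun θ : ℝ =>
    deriv (circleMap 0 R) θ • (periodize g (log (circleMap 0 R θ)) / (circleMap 0 R θ - w))) h2π
  simp only [hpt, mul_zero, mul_one] at h3
  rw [intervalIntegral.integral_const_mul, htsum, mul_zero] at h3
  rw [circleIntegral]
  exact ((smul_eq_zero.1 h3.symm).resolve_left (inv_ne_zero h2π))

/-- A periodized bounded holomorphic function on the right half-plane, seen as a function on the
exterior of the disk, has a zero at infinity. -/
lemma exists_norm_periodize_log_le {g : ℂ → ℂ} (hg : DifferentiableOn ℂ g {z | 0 < z.re})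
    (hsum : LocallySummableTranslates g)
    (hbd : ∀ a : ℝ, 0 < a → ∃ M, ∀ z : ℂ, a ≤ z.re → ‖g z‖ ≤ M) :
    ∃ C : ℝ, 0 < C ∧ ∀ w : ℂ, Real.exp 2 ≤ ‖w‖ → ‖periodize g (log w)‖ ≤ C / ‖w‖ := by
  set h : ℂ → ℂ := fun v => periodize g (log v) with hh
  set r : ℝ := Real.exp 1 with hr
  have hr1 : 1 < r := Real.one_lt_exp_iff.2 one_pos
  have hr0 : 0 < r := one_pos.trans hr1
  have hhd : DifferentiableOn ℂ h {v | 1 < ‖v‖} := fun v hv =>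
    (differentiableAt_periodize_log hg hsum hv).differentiableWithinAt
  have hopen : IsOpen {v : ℂ | 1 < ‖v‖} := isOpen_lt continuous_const continuous_norm
  obtain ⟨B, hB⟩ := (isCompact_sphere (0 : ℂ) r).exists_bound_of_continuousOn
    (hhd.continuousOn.mono fun v hv => by
      rw [mem_sphere_zero_iff_norm] at hv
      rwa [mem_ofPred_eq, hv])
  have hB0 : 0 ≤ B := (norm_nonneg _).trans (hB r (by simp [abs_of_pos hr0]))
  refine ⟨2 * r * (B + 1), by positivity, fun w hw => ?_⟩
  have hr2 : Real.exp 2 = r * r := by rw [hr, ← Real.exp_add]; norm_num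
  have h2r : 2 ≤ r := by
    have := Real.add_one_le_exp (1 : ℝ)
    linarith
  have hrw : 2 * r ≤ ‖w‖ := by nlinarith
  have hw1 : 1 < ‖w‖ := by linarith
  set R : ℝ := ‖w‖ + 1 with hRdef
  have hR1 : 1 < R := by linarith
  obtain ⟨M, hM⟩ := hbd (Real.log R) (Real.log_pos hR1)
  have hbig := circleIntegral_periodize_log_div_eq_zero hg hsum hR1 (lt_add_one ‖w‖) hM
  have hds : DifferentiableOn ℂ (dslope h w) {v | 1 < ‖v‖} :=
    (differentiableOn_dslope (hopen.mem_nhds hw1)).2 hhd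
  have hann := circleIntegral_sub_center_inv_smul_eq_of_differentiable_on_annulus_off_countable
    (c := 0) hr0 (show r ≤ R by linarith) (f := fun v => v * dslope h w v) countable_empty
    (fun v hv => by
      have hv1 : 1 < ‖v‖ := by
        have := hv.2
        rw [mem_ball_zero_iff, not_lt] at this
        linarith
      exact (continuousAt_id.mul
        (hds.differentiableAt (hopen.mem_nhds hv1)).continuousAt).continuousWithinAt)
    (fun v hv => by
      have hv1 : 1 < ‖v‖ := by
        have := hv.1.2
        rw [mem_closedBall_zero_iff, not_le] at this
        linarith
      exact differentiableAt_id.mul (hds.differentiableAt (hopen.mem_nhds hv1)))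
  have hsplit : ∀ ρ : ℝ, 1 < ρ → ρ ≠ ‖w‖ →
      ∮ v in C(0, ρ), (v - 0)⁻¹ • (v * dslope h w v) =
        (∮ v in C(0, ρ), h v / (v - w)) - h w * ∮ v in C(0, ρ), (v - w)⁻¹ := by
    intro ρ hρ hρw
    have hsph : ∀ v ∈ sphere (0 : ℂ) ρ, 1 < ‖v‖ ∧ v - w ≠ 0 := fun v hv => by
      rw [mem_sphere_zero_iff_norm] at hv
      refine ⟨hv ▸ hρ, fun h0 => hρw ?_⟩
      rw [← hv, sub_eq_zero.1 h0]
    have hinv : ContinuousOn (fun v : ℂ => (v - w)⁻¹) (sphere 0 ρ) :=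
      ContinuousOn.inv₀ (by fun_prop) fun v hv => (hsph v hv).2
    have hρ0 : 0 ≤ ρ := by linarith
    rw [← circleIntegral.integral_const_mul, ← circleIntegral.integral_sub]
    · refine circleIntegral.integral_congr hρ0 fun v hv => ?_
      have hv0 : v ≠ 0 := norm_pos_iff.1 (one_pos.trans (hsph v hv).1)
      have hvw : v ≠ w := sub_ne_zero.1 (hsph v hv).2
      simp only [sub_zero, smul_eq_mul]
      rw [inv_mul_cancel_left₀ hv0, dslope_of_ne _ hvw, slope_def_field]
      have := (hsph v hv).2
      field_simp
    · refine ContinuousOn.circleIntegrable hρ0 ?_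
      simp only [div_eq_mul_inv]
      exact (hhd.continuousOn.mono fun v hv => (hsph v hv).1).mul hinv
    · exact (continuousOn_const.mul hinv).circleIntegrable hρ0
  rw [hsplit R hR1 (by simp [hRdef]), hsplit r hr1 (by linarith), hbig,
    circleIntegral.integral_sub_inv_of_mem_ball (by rw [mem_ball_zero_iff]; linarith)] at hann
  have hsmall : ∮ v in C(0, r), (v - w)⁻¹ = 0 := by
    have hne : ∀ v ∈ closedBall (0 : ℂ) r, v - w ≠ 0 := fun v hv h0 => by
      rw [mem_closedBall_zero_iff, sub_eq_zero.1 h0] at hv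
      linarith
    refine circleIntegral_eq_zero_of_differentiable_on_off_countable hr0.le countable_empty
      (ContinuousOn.inv₀ (by fun_prop) hne) fun v hv => ?_
    exact DifferentiableAt.inv (by fun_prop) (hne v (ball_subset_closedBall hv.1))
  rw [hsmall, mul_zero, sub_zero, zero_sub] at hann
  have hest : ‖∮ v in C(0, r), h v / (v - w)‖ ≤ 2 * π * r * (B / (‖w‖ / 2)) := by
    refine circleIntegral.norm_integral_le_of_norm_le_const hr0.le fun v hv => ?_
    have h1 := hB v hv
    rw [mem_sphere_zero_iff_norm] at hv
    have h2 : ‖w‖ / 2 ≤ ‖v - w‖ := by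
      have := norm_sub_norm_le w v
      rw [norm_sub_rev] at this
      linarith
    rw [norm_div]
    have : 0 < ‖w‖ / 2 := by linarith
    gcongr
  rw [← hann, norm_neg, norm_mul, norm_mul, norm_mul, norm_I, norm_real,
    Real.norm_of_nonneg Real.pi_pos.le, Complex.norm_two, mul_one] at hest
  have hw0 : 0 < ‖w‖ := by linarith
  have hπ : 0 < 2 * π := by positivity
  have h4 : ‖h w‖ * (2 * π) ≤ (2 * r * B / ‖w‖) * (2 * π) := by
    refine hest.trans (le_of_eq ?_)
    field_simp
  refine (le_of_mul_le_mul_right h4 hπ).trans ?_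
  gcongr
  linarith

/-- The exponential of the right half-plane factors through every simply connected covering of the
exterior of the disk, by a conformal isomorphism. -/
lemma exists_uniformization {V : Set ℂ} (hVopen : IsOpen V) (hVconn : IsConnected V)
    (hVsc : SimplyConnectedSpace ↥V) {f : ℂ → ℂ} (hf : DifferentiableOn ℂ f V)
    (hmaps : MapsTo f V {w : ℂ | 1 < ‖w‖})
    (hcov : IsCoveringMap (MapsTo.restrict f V {w : ℂ | 1 < ‖w‖} hmaps)) :
    ∃ ψ : ℂ → ℂ, DifferentiableOn ℂ ψ {ζ | 0 < ζ.re} ∧ BijOn ψ {ζ | 0 < ζ.re} V ∧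
      ∀ ζ : ℂ, 0 < ζ.re → f (ψ ζ) = exp ζ := by
  set H : Set ℂ := {ζ | 0 < ζ.re} with hH
  have hHopen : IsOpen H := isOpen_lt continuous_const continuous_re
  have hexp : ∀ ζ : ℂ, 1 < ‖exp ζ‖ ↔ ζ ∈ H := fun ζ => by
    rw [norm_exp, Real.one_lt_exp_iff, hH, mem_ofPred_eq]
  obtain ⟨z₀, hz₀⟩ := hVconn.nonempty
  have hf0 : f z₀ ≠ 0 := norm_pos_iff.1 (one_pos.trans (hmaps hz₀))
  have hζ₀ : log (f z₀) ∈ H := (hexp _).1 (by rw [exp_log hf0]; exact hmaps hz₀)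
  have : ContractibleSpace H := (convex_halfSpace_re_gt 0).contractibleSpace ⟨_, hζ₀⟩
  have : LocallyPathConnectedSpace H := hHopen.locallyPathConnectedSpace
  have : LocallyPathConnectedSpace V := hVopen.locallyPathConnectedSpace
  have hfc : Continuous fun z : V => f z := hf.continuousOn.domRestrict
  obtain ⟨Ψ, ⟨hΨ0, hΨ⟩, -⟩ := hcov.existsUnique_continuousMap_lifts
    (⟨fun ζ : H => ⟨exp ζ, (hexp ζ).2 ζ.2⟩, by fun_prop⟩ : C(H, {w : ℂ | 1 < ‖w‖}))
    ⟨log (f z₀), hζ₀⟩ ⟨z₀, hz₀⟩ (Subtype.ext (exp_log hf0).symm)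
  have hfΨ : ∀ ζ : H, f (Ψ ζ) = exp ζ := fun ζ => congrArg Subtype.val (congrFun hΨ ζ)
  obtain ⟨Φ, ⟨hΦ0, hΦ⟩, -⟩ := isCoveringMapOn_exp.existsUnique_continuousMap_lifts
    (⟨fun z : V => f z, hfc⟩ : C(V, ℂ)) (a₀ := ⟨z₀, hz₀⟩) (e₀ := log (f z₀)) (exp_log hf0)
    (fun z => norm_pos_iff.1 (one_pos.trans (hmaps z.2)))
  have hΦf : ∀ z : V, exp (Φ z) = f z := fun z => congrFun hΦ z
  have hΦH : ∀ z : V, Φ z ∈ H := fun z => (hexp _).1 (by rw [hΦf]; exact hmaps z.2)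
  have hΦΨ : ∀ ζ : H, Φ (Ψ ζ) = ζ := by
    obtain ⟨F, -, hF⟩ := isCoveringMapOn_exp.existsUnique_continuousMap_lifts
      (⟨fun ζ : H => exp ζ, by fun_prop⟩ : C(H, ℂ)) (a₀ := ⟨log (f z₀), hζ₀⟩)
      (e₀ := log (f z₀)) rfl (fun ζ => exp_ne_zero _)
    have h1 := hF (Φ.comp Ψ) ⟨by simp [hΨ0, hΦ0], by
      funext ζ
      simp [hΦf, hfΨ]⟩
    have h2 := hF ⟨fun ζ => ζ, continuous_subtype_val⟩ ⟨rfl, rfl⟩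
    intro ζ
    exact congrArg (fun G : C(H, ℂ) => G ζ) (h1.trans h2.symm)
  have hΨΦ : ∀ z : V, Ψ ⟨Φ z, hΦH z⟩ = z := by
    have : ConnectedSpace V := isConnected_iff_connectedSpace.1 hVconn
    have h1 := hcov.eq_of_comp_eq (g₁ := fun z : V => Ψ ⟨Φ z, hΦH z⟩) (g₂ := fun z => z)
      (by fun_prop) continuous_id (by
        funext z
        exact Subtype.ext ((hfΨ _).trans (hΦf z))) ⟨z₀, hz₀⟩ (by
        refine Eq.trans ?_ hΨ0
        congr 1
        exact Subtype.ext hΦ0)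
    exact fun z => congrFun h1 z
  classical
  set ψ : ℂ → ℂ := fun ζ => if h : ζ ∈ H then Ψ ⟨ζ, h⟩ else 0 with hψ
  have hψe : ∀ ζ : ℂ, ∀ h : ζ ∈ H, ψ ζ = Ψ ⟨ζ, h⟩ := fun ζ h => dif_pos h
  have hψV : MapsTo ψ H V := fun ζ h => by
    rw [hψe ζ h]
    exact (Ψ _).2
  have hψf : ∀ ζ ∈ H, f (ψ ζ) = exp ζ := fun ζ h => by rw [hψe ζ h, hfΨ]
  have hψc : ContinuousOn ψ H := by
    rw [continuousOn_iff_continuous_domRestrict]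
    have : H.domRestrict ψ = fun ζ => (Ψ ζ : ℂ) := funext fun ζ => hψe ζ ζ.2
    rw [this]
    fun_prop
  refine ⟨ψ, fun ζ₁ hζ₁ => ?_, ⟨hψV, ?_, ?_⟩, hψf⟩
  · have hfa : AnalyticAt ℂ f (ψ ζ₁) := hf.analyticAt (hVopen.mem_nhds (hψV hζ₁))
    have hFa : AnalyticAt ℂ (fun z => ζ₁ + log (f z / exp ζ₁)) (ψ ζ₁) := by
      refine analyticAt_const.add ((hfa.div analyticAt_const (exp_ne_zero _)).clog ?_)
      rw [Pi.div_apply, hψf ζ₁ hζ₁, div_self (exp_ne_zero _)]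
      exact one_mem_slitPlane
    refine (differentiableAt_of_eventually_rightInverse hFa ?_ ?_).differentiableWithinAt
    · filter_upwards [hHopen.mem_nhds hζ₁] with ζ hζ using hψc.continuousAt (hHopen.mem_nhds hζ)
    · filter_upwards [hHopen.mem_nhds hζ₁, ball_mem_nhds ζ₁ Real.pi_pos] with ζ hζ hζb
      rw [hψf ζ hζ, ← exp_sub, log_exp]
      · ring
      · have := (abs_im_le_norm (ζ - ζ₁)).trans_lt (mem_ball_iff_norm.1 hζb)
        exact (abs_lt.1 this).1
      · have := (abs_im_le_norm (ζ - ζ₁)).trans_lt (mem_ball_iff_norm.1 hζb)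
        exact (abs_lt.1 this).2.le
  · intro ζ hζ ζ' hζ' heq
    rw [hψe ζ hζ, hψe ζ' hζ'] at heq
    have := congrArg Φ (Subtype.ext heq)
    rwa [hΦΨ, hΦΨ] at this
  · intro z hz
    refine ⟨Φ ⟨z, hz⟩, hΦH _, ?_⟩
    rw [hψe _ (hΦH _), hΨΦ]

/-- The fibre of a covering of the exterior of the disk that is uniformized by the exponential is
parametrized by the branches of the logarithm. -/
lemma exists_equiv_fiber {V : Set ℂ} {f ψ : ℂ → ℂ} (hbij : BijOn ψ {ζ | 0 < ζ.re} V)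
    (hfψ : ∀ ζ : ℂ, 0 < ζ.re → f (ψ ζ) = exp ζ) {ζ : ℂ} (hζ : 0 < ζ.re) :
    ∃ e : ℤ ≃ {z : ℂ // z ∈ V ∧ f z = exp ζ}, ∀ k : ℤ, (e k : ℂ) = ψ (ζ + k * (2 * π * I)) := by
  have hmem : ∀ k : ℤ, ζ + k * (2 * π * I) ∈ {ζ : ℂ | 0 < ζ.re} := fun k => by
    rwa [mem_ofPred_eq, re_add_int_mul_two_pi_I]
  refine ⟨Equiv.ofBijective (fun k => ⟨ψ (ζ + k * (2 * π * I)), hbij.mapsTo (hmem k), ?_⟩)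
    ⟨fun k l hkl => ?_, ?_⟩, fun k => rfl⟩
  · rw [hfψ _ (hmem k), exp_add, exp_int_mul_two_pi_mul_I, mul_one]
  · have h1 := hbij.injOn (hmem k) (hmem l) (congrArg Subtype.val hkl)
    have h2 := mul_right_cancel₀ two_pi_I_ne_zero (add_left_cancel h1)
    exact_mod_cast h2
  · rintro ⟨z, hzV, hz⟩
    obtain ⟨ξ, hξ, rfl⟩ := hbij.surjOn hzV
    rw [hfψ ξ hξ] at hz
    obtain ⟨n, hn⟩ := exp_eq_exp_iff_exists_int.1 hz
    exact ⟨n, Subtype.ext (congrArg ψ hn).symm⟩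

theorem pushforward_simple_pole (V : Set ℂ)
    (hVopen : IsOpen V) (hVne : V ≠ Set.univ)
    (hVunb : ¬ Bornology.IsBounded V) (hVconn : IsConnected V)
    (hVsc : SimplyConnectedSpace ↥V)
    (hVdisj : ∀ z ∈ V, 1 < ‖z‖)
    (f : ℂ → ℂ) (hf : DifferentiableOn ℂ f V)
    (hmaps : Set.MapsTo f V {w : ℂ | 1 < ‖w‖})
    (hcov : IsCoveringMap (Set.MapsTo.restrict f V {w : ℂ | 1 < ‖w‖} hmaps))
    (t : ℝ) (ht0 : 0 < t) (ht2 : t < 2)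
    (harea : ∀ w : ℂ, 1 < ‖w‖ →
      Summable (fun z : {z : ℂ // z ∈ V ∧ f z = w} =>
        1 / (‖(z : ℂ)‖ ^ t * ‖deriv f (z : ℂ)‖ ^ t)))
    (q : ℂ → ℂ) (hq : DifferentiableOn ℂ q V)
    (C : ℝ) (hC : 0 < C) (hqbound : ∀ z ∈ V, ‖q z‖ ≤ C / ‖z‖ ^ 2) :
    (∀ w : ℂ, 1 < ‖w‖ →
      Summable (fun z : {z : ℂ // z ∈ V ∧ f z = w} =>
        ‖q (z : ℂ) / (deriv f (z : ℂ)) ^ 2‖)) ∧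
    ∃ ε C' R : ℝ, 0 < ε ∧ 0 < C' ∧ 1 < R ∧ ∀ w : ℂ, R ≤ ‖w‖ →
      ‖∑' z : {z : ℂ // z ∈ V ∧ f z = w}, q (z : ℂ) / (deriv f (z : ℂ)) ^ 2‖ ≤
        C' * Real.log ‖w‖ ^ 2 / ‖w‖ ^ (2 + ε) := by
  obtain ⟨ψ, hψd, hbij, hfψ⟩ := exists_uniformization hVopen hVconn hVsc hf hmaps hcov
  have hHopen : IsOpen {ζ : ℂ | 0 < ζ.re} := isOpen_lt continuous_const continuous_re
  have hψ0 : ∀ ζ : ℂ, 0 < ζ.re → ψ ζ ≠ 0 := fun ζ hζ =>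
    norm_pos_iff.1 (one_pos.trans (hVdisj _ (hbij.mapsTo hζ)))
  have hderiv : ∀ ζ : ℂ, 0 < ζ.re → deriv f (ψ ζ) * deriv ψ ζ = exp ζ := by
    intro ζ hζ
    have h1 := (hf.differentiableAt (hVopen.mem_nhds (hbij.mapsTo hζ))).hasDerivAt.comp ζ
      (hψd.differentiableAt (hHopen.mem_nhds hζ)).hasDerivAt
    have h2 : f ∘ ψ =ᶠ[𝓝 ζ] exp := by
      filter_upwards [hHopen.mem_nhds hζ] with ξ hξ using hfψ ξ hξ
    exact h1.unique ((hasDerivAt_exp ζ).congr_of_eventuallyEq h2)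
  have hf'0 : ∀ ζ : ℂ, 0 < ζ.re → deriv f (ψ ζ) ≠ 0 := fun ζ hζ =>
    left_ne_zero_of_mul (hderiv ζ hζ ▸ exp_ne_zero ζ)
  have hψ'0 : ∀ ζ : ℂ, 0 < ζ.re → deriv ψ ζ ≠ 0 := fun ζ hζ =>
    right_ne_zero_of_mul (hderiv ζ hζ ▸ exp_ne_zero ζ)
  have hψ'd : DifferentiableOn ℂ (deriv ψ) {ζ | 0 < ζ.re} := hψd.deriv hHopen
  set P : ℂ → ℂ := fun ζ => deriv ψ ζ / ψ ζ with hP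
  have hPd : DifferentiableOn ℂ P {ζ | 0 < ζ.re} := hψ'd.div hψd hψ0
  have hP0 : ∀ ζ : ℂ, 0 < ζ.re → P ζ ≠ 0 := fun ζ hζ => div_ne_zero (hψ'0 ζ hζ) (hψ0 ζ hζ)
  have hball : ∀ c : ℂ, ∀ r : ℝ, ∀ z ∈ ball c r, c.re - r < z.re := fun c r z hz => by
    have := (abs_re_le_norm (z - c)).trans_lt (mem_ball_iff_norm.1 hz)
    rw [sub_re, abs_lt] at this
    linarith
  have hPle : ∀ ζ : ℂ, 0 < ζ.re → ‖P ζ‖ ≤ 192 * π / ζ.re := fun ζ hζ => by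
    have hsub : ball ζ ζ.re ⊆ {ζ : ℂ | 0 < ζ.re} := fun z hz => by
      have := hball _ _ z hz
      rwa [sub_self] at this
    exact norm_logDeriv_le_of_injOn hζ (hψd.mono hsub) (fun z hz => hψ0 z (hsub hz))
      (hbij.injOn.mono hsub)
  set g : ℂ → ℂ := fun ζ => deriv ψ ζ ^ 2 * q (ψ ζ) with hg
  have hgd : DifferentiableOn ℂ g {ζ | 0 < ζ.re} :=
    (hψ'd.pow 2).mul (hq.comp hψd hbij.mapsTo)
  have hgP : ∀ ζ : ℂ, 0 < ζ.re → ‖g ζ‖ ≤ C * ‖P ζ‖ ^ 2 := fun ζ hζ => by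
    simp only [hg, hP, norm_mul, norm_pow, norm_div]
    refine (mul_le_mul_of_nonneg_left (hqbound _ (hbij.mapsTo hζ)) (by positivity)).trans
      (le_of_eq ?_)
    ring
  have hpushforward : ∀ ζ : ℂ, 0 < ζ.re →
      q (ψ ζ) / deriv f (ψ ζ) ^ 2 = g ζ / exp ζ ^ 2 := fun ζ hζ => by
    have h1 := hf'0 ζ hζ
    have h2 := hψ'0 ζ hζ
    rw [← hderiv ζ hζ, hg]
    field_simp
  have hfiber : ∀ ζ : ℂ, 0 < ζ.re → 1 / (‖ψ ζ‖ ^ t * ‖deriv f (ψ ζ)‖ ^ t) =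
      ‖P ζ‖ ^ t / ‖exp ζ‖ ^ t := fun ζ hζ => by
    have h1 := norm_pos_iff.2 (hf'0 ζ hζ)
    have h2 := norm_pos_iff.2 (hψ'0 ζ hζ)
    have h3 := norm_pos_iff.2 (hψ0 ζ hζ)
    rw [← hderiv ζ hζ, hP, ← Real.mul_rpow h3.le h1.le,
      ← Real.div_rpow (norm_nonneg _) (norm_nonneg _), ← Real.one_rpow t,
      ← Real.div_rpow zero_le_one (by positivity), norm_mul]
    simp only [norm_div]
    congr 1
    field_simp
  have hre : ∀ ζ : ℂ, 0 < ζ.re → ∀ k : ℤ, 0 < (ζ + k * (2 * π * I)).re := fun ζ hζ k => by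
    rwa [re_add_int_mul_two_pi_I]
  have hexp : ∀ (ζ : ℂ) (k : ℤ), exp (ζ + k * (2 * π * I)) = exp ζ := fun ζ k => by
    rw [exp_add, exp_int_mul_two_pi_mul_I, mul_one]
  have hPsum : ∀ ζ : ℂ, 0 < ζ.re → Summable fun k : ℤ => ‖P (ζ + k * (2 * π * I))‖ ^ t := by
    intro ζ hζ
    obtain ⟨e, he⟩ := exists_equiv_fiber hbij hfψ hζ
    have hw : 1 < ‖exp ζ‖ := by rwa [norm_exp, Real.one_lt_exp_iff]
    have h1 := (e.summable_iff.2 (harea _ hw)).mul_right (‖exp ζ‖ ^ t)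
    refine h1.congr fun k => ?_
    have : 0 < ‖exp ζ‖ ^ t := by positivity
    rw [Function.comp_apply, he, hfiber _ (hre ζ hζ k), hexp, div_mul_cancel₀ _ this.ne']
  have hgsum : LocallySummableTranslates g := by
    intro ζ hζ
    set M : ℝ := 192 * π / (ζ.re / 2) + 1 with hM
    refine ⟨ball ζ ((2 - t) / 8 * (ζ.re / 2)), ball_mem_nhds _ (mul_pos (by linarith)
      (by linarith)), fun k => C * (M ^ (2 - t) * ‖P (ζ + k * (2 * π * I))‖ ^ t),
      ((hPsum ζ hζ).mul_left _).mul_left _, fun y hy hy0 k => ?_⟩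
    have hhalf : ∀ z ∈ ball (ζ + k * (2 * π * I)) (ζ.re / 2), ζ.re / 2 < z.re := fun z hz => by
      have := hball _ _ z hz
      rw [re_add_int_mul_two_pi_I] at this
      linarith
    have hpos : ∀ z ∈ ball (ζ + k * (2 * π * I)) (ζ.re / 2), 0 < z.re := fun z hz =>
      (half_pos hζ).trans (hhalf z hz)
    refine (hgP _ (hre y hy0 k)).trans (mul_le_mul_of_nonneg_left ?_ hC.le)
    refine norm_sq_le_of_ne_zero (half_pos hζ) ht0 ht2 (hPd.mono hpos)
      (fun z hz => hP0 z (hpos z hz)) (fun z hz => ?_) ?_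
    · refine ((hPle z (hpos z hz)).trans ?_).trans_lt (lt_add_one _)
      have := (hhalf z hz).le
      have := half_pos hζ
      gcongr
    · rwa [mem_ball, dist_add_right]
  have hgbd : ∀ a : ℝ, 0 < a → ∃ M, ∀ z : ℂ, a ≤ z.re → ‖g z‖ ≤ M := fun a ha =>
    ⟨C * (192 * π / a) ^ 2, fun z hz => (hgP z (ha.trans_le hz)).trans (by
      have := hPle z (ha.trans_le hz)
      have h2 : 192 * π / z.re ≤ 192 * π / a := by gcongr
      have := this.trans h2
      gcongr)⟩
  refine ⟨fun w hw => ?_, ?_⟩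
  · have hw0 : w ≠ 0 := norm_pos_iff.1 (one_pos.trans hw)
    obtain ⟨ζ, hζ, rfl⟩ : ∃ ζ : ℂ, 0 < ζ.re ∧ exp ζ = w := ⟨log w, re_log_pos hw, exp_log hw0⟩
    obtain ⟨e, he⟩ := exists_equiv_fiber hbij hfψ hζ
    obtain ⟨U, hU, b, hb, hUb⟩ := hgsum ζ hζ
    rw [← e.summable_iff]
    refine ((hb.of_nonneg_of_le (fun _ => norm_nonneg _) (hUb ζ (mem_of_mem_nhds hU) hζ)).mul_right
      (‖exp ζ ^ 2‖⁻¹)).congr fun k => ?_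
    rw [Function.comp_apply, he, hpushforward _ (hre ζ hζ k), hexp, norm_div, div_eq_mul_inv]
  · obtain ⟨C', hC', hbound⟩ := exists_norm_periodize_log_le hgd hgsum hgbd
    refine ⟨1, C', Real.exp 2, one_pos, hC', Real.one_lt_exp_iff.2 two_pos, fun w hwR => ?_⟩
    have hw : 1 < ‖w‖ := (Real.one_lt_exp_iff.2 two_pos).trans_le hwR
    have hw0 : 0 < ‖w‖ := one_pos.trans hw
    have hlog : 1 ≤ Real.log ‖w‖ := by
      have := (Real.le_log_iff_exp_le hw0).2 hwR
      linarith
    have htsum : ∑' z : {z : ℂ // z ∈ V ∧ f z = w}, q (z : ℂ) / (deriv f (z : ℂ)) ^ 2 =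
        periodize g (log w) / w ^ 2 := by
      obtain ⟨ζ, hζ, rfl⟩ : ∃ ζ : ℂ, 0 < ζ.re ∧ exp ζ = w :=
        ⟨log w, re_log_pos hw, exp_log (norm_pos_iff.1 hw0)⟩
      obtain ⟨e, he⟩ := exists_equiv_fiber hbij hfψ hζ
      rw [← e.tsum_eq, periodize_log_exp, periodize, ← tsum_div_const]
      refine tsum_congr fun k => ?_
      rw [he, hpushforward _ (hre ζ hζ k), hexp]
    rw [htsum, norm_div, norm_pow, Real.rpow_add hw0, Real.rpow_one, Real.rpow_two,
      mul_comm (‖w‖ ^ 2), ← div_div]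
    have h1 : C' / ‖w‖ ≤ C' * Real.log ‖w‖ ^ 2 / ‖w‖ := by
      gcongr
      exact le_mul_of_one_le_right hC'.le (one_le_pow₀ hlog)
    gcongr
    exact (hbound w hwR).trans h1
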